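/- arXiv:2007.06442 — 2 statements merged into one kernel-verified Lean document; each statement's English description precedes it below -/
import Mathlib

section
/- If R₁ and R₂ are both RAFs for a catalytic reaction system Q = (X, R, C, F), then their union R₁ ∪ R₂ is also a RAF for Q. -/
/-- The closure `cl_{R'}(F)`: the smallest subset `W` of `X` containing the food set `F`
such that for every reaction `r ∈ R'` whose reactants `ρ r` all lie in `W`,
the products `π r` also lie in `W`. -/
def clF {X R : Type*} (ρ : R → Finset X) (π : R → Finset X) (F : Set X)
    (R' : Set R) : Set X :=
  ⋂₀ {W : Set X | F ⊆ W ∧ ∀ r ∈ R', ↑(ρ r) ⊆ W → ↑(π r) ⊆ W}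

/-- `R'` is a RAF (Reflexively Autocatalytic and F-generated set) for the catalytic
reaction system `(X, R, C, F)`: `R'` is nonempty, every reaction in `R'` has a catalyst
lying in the closure of the food set under `R'`, and every reaction in `R'` has all its
reactants in that closure. -/
def IsRAF {X R : Type*} (ρ : R → Finset X) (π : R → Finset X)
    (C : Set (X × R)) (F : Set X) (R' : Set R) : Prop :=
  R'.Nonempty ∧
  (∀ r ∈ R', ∃ x : X, (x, r) ∈ C ∧ x ∈ clF ρ π F R') ∧
  (∀ r ∈ R', ↑(ρ r) ⊆ clF ρ π F R')

theorem clF_mono {X R : Type*} (ρ : R → Finset X) (π : R → Finset X) (F : Set X)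
    {A B : Set R} (h : A ⊆ B) : clF ρ π F A ⊆ clF ρ π F B :=
  fun _ hx W hW => hx W ⟨hW.1, fun r hr => hW.2 r (h hr)⟩

/-- If `R₁` and `R₂` are both RAFs for the catalytic reaction system `Q = (X, R, C, F)`,
then so is their union `R₁ ∪ R₂`. -/
theorem union_isRAF {X R : Type*} (ρ : R → Finset X) (π : R → Finset X)
    (C : Set (X × R)) (F : Set X)
    (hρ : ∀ r : R, (ρ r).Nonempty)
    (R₁ R₂ : Set R)
    (h₁ : IsRAF ρ π C F R₁) (h₂ : IsRAF ρ π C F R₂) :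
    IsRAF ρ π C F (R₁ ∪ R₂) := by
  have m₁ : clF ρ π F R₁ ⊆ clF ρ π F (R₁ ∪ R₂) := clF_mono ρ π F Set.subset_union_left
  have m₂ : clF ρ π F R₂ ⊆ clF ρ π F (R₁ ∪ R₂) := clF_mono ρ π F Set.subset_union_right
  obtain ⟨n₁, c₁, g₁⟩ := h₁
  obtain ⟨_, c₂, g₂⟩ := h₂
  refine ⟨n₁.mono Set.subset_union_left, ?_, ?_⟩
  · rintro r (hr | hr)
    · obtain ⟨x, hx, hc⟩ := c₁ r hr
      exact ⟨x, hx, m₁ hc⟩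
    · obtain ⟨x, hx, hc⟩ := c₂ r hr
      exact ⟨x, hx, m₂ hc⟩
  · rintro r (hr | hr)
    · exact (g₁ r hr).trans m₁
    · exact (g₂ r hr).trans m₂
end

section
/- If a catalytic reaction system Q = (X, R, C, F) with R finite contains at least one RAF, then it contains a unique maximal RAF, namely the union of all RAFs of Q; this maximal RAF is itself a RAF and contains every RAF of Q as a subset. -/
/-- If a catalytic reaction system with finitely many reactions contains at least one RAF,
then the union of all its RAFs is itself a RAF, it contains every RAF as a subset, and it
is the unique maximal RAF (any RAF not properly contained in another RAF equals it). -/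
theorem exists_unique_maximal_RAF {X R : Type*} [Finite R]
    (ρ : R → Finset X) (π : R → Finset X)
    (C : Set (X × R)) (F : Set X)
    (hρ : ∀ r : R, (ρ r).Nonempty)
    (hex : ∃ R' : Set R, IsRAF ρ π C F R') :
    IsRAF ρ π C F (⋃₀ {R' : Set R | IsRAF ρ π C F R'}) ∧
    (∀ R' : Set R, IsRAF ρ π C F R' → R' ⊆ ⋃₀ {R' : Set R | IsRAF ρ π C F R'}) ∧
    (∀ M : Set R, IsRAF ρ π C F M →
      (∀ M' : Set R, IsRAF ρ π C F M' → M ⊆ M' → M = M') →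
      M = ⋃₀ {R' : Set R | IsRAF ρ π C F R'}) := by
  have mono : ∀ A B : Set R, A ⊆ B → clF ρ π F A ⊆ clF ρ π F B := by
    intro A B hAB x hx W hW
    exact hx W ⟨hW.1, fun r hr => hW.2 r (hAB hr)⟩
  have sub : ∀ R' : Set R, IsRAF ρ π C F R' → R' ⊆ ⋃₀ {R' : Set R | IsRAF ρ π C F R'} :=
    fun R' h r hr => ⟨R', h, hr⟩
  have raf : IsRAF ρ π C F (⋃₀ {R' : Set R | IsRAF ρ π C F R'}) := by
    refine ⟨?_, ?_, ?_⟩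
    · obtain ⟨R', h⟩ := hex
      exact h.1.mono (sub R' h)
    · rintro r ⟨R', h, hr⟩
      obtain ⟨x, hxC, hx⟩ := h.2.1 r hr
      exact ⟨x, hxC, mono _ _ (sub R' h) hx⟩
    · rintro r ⟨R', h, hr⟩
      exact (h.2.2 r hr).trans (mono _ _ (sub R' h))
  exact ⟨raf, sub, fun M hM hmax => hmax _ raf (sub M hM)⟩
end
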